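/- There exist finite connected simple graphs G and G′, each with 8 vertices and 12 edges (hence of genus g = |E| − |V| + 1 = 5), such that T_G = T_{G′} as polynomials, G and G′ have the same two-variable zeta function (for every pair of integers (d, r), the number of divisor classes of degree d and Baker–Norine rank r on G equals that number on G′), and Jac(G) ≅ ℤ/42ℤ × ℤ/7ℤ while Jac(G′) ≅ ℤ/294ℤ; in particular Jac(G) and Jac(G′) are not isomorphic. -/

import Mathlib

open scoped Classical

namespace BNGraph

variable {V : Type} [Fintype V]

/-- The degree of a divisor `D : V → ℤ`: the sum of its values. -/
def degSum (D : V → ℤ) : ℤ := ∑ v, D v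

/-- A divisor is effective if all its values are nonnegative. -/
def Effective (D : V → ℤ) : Prop := ∀ v, 0 ≤ D v

/-- The combinatorial Laplacian of a graph, as a homomorphism on divisors. -/
noncomputable def lap (G : SimpleGraph V) : (V → ℤ) →+ (V → ℤ) where
  toFun f := fun v => (G.degree v : ℤ) * f v - ∑ w ∈ G.neighborFinset v, f w
  map_zero' := by
    funext v; simp
  map_add' f g := by
    funext v
    simp only [Pi.add_apply, Finset.sum_add_distrib]
    ring

/-- The subgroup of principal divisors: the image of the Laplacian. -/
noncomputable def Principal (G : SimpleGraph V) : AddSubgroup (V → ℤ) := (lap G).range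

/-- Linear equivalence of divisors. -/
def LinEquiv (G : SimpleGraph V) (D D' : V → ℤ) : Prop := D - D' ∈ Principal G

/-- A divisor is winnable if it is linearly equivalent to an effective divisor. -/
def Winnable (G : SimpleGraph V) (D : V → ℤ) : Prop :=
  ∃ E : V → ℤ, Effective E ∧ LinEquiv G D E

/-- The Baker–Norine rank of a divisor: the largest `r ≥ 0` such that `D - E` is
winnable for every effective divisor `E` of degree `r`, or `-1` if there is no such `r`
(equivalently, if `D` itself is not winnable). -/
noncomputable def bnRank (G : SimpleGraph V) (D : V → ℤ) : ℤ :=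
  sSup {r : ℤ | r = -1 ∨ (0 ≤ r ∧
    ∀ E : V → ℤ, Effective E → degSum E = r → Winnable G (D - E))}

/-- The Picard group of a graph: divisors modulo principal divisors. -/
abbrev Pic (G : SimpleGraph V) : Type _ := (V → ℤ) ⧸ Principal G

/-- The number of divisor classes of degree `d` and Baker–Norine rank `r`. -/
noncomputable def numClasses (G : SimpleGraph V) (d r : ℤ) : ℕ :=
  Set.ncard {c : Pic G | ∃ D : V → ℤ,
    QuotientAddGroup.mk' (Principal G) D = c ∧ degSum D = d ∧ bnRank G D = r}

/-- Two graphs have the same two-variable zeta function iff for every degree `d` and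
rank `r` they have the same number of divisor classes of degree `d` and rank `r`. -/
def SameZeta {W : Type} [Fintype W] (G : SimpleGraph V) (G' : SimpleGraph W) : Prop :=
  ∀ d r : ℤ, numClasses G d r = numClasses G' d r

/-- Degree as a homomorphism on divisors. -/
def degHom : (V → ℤ) →+ ℤ where
  toFun := degSum
  map_zero' := by simp [degSum]
  map_add' f g := by simp [degSum, Finset.sum_add_distrib]

/-- The subgroup of divisors of degree zero. -/
def Deg0 (V : Type) [Fintype V] : AddSubgroup (V → ℤ) := (degHom (V := V)).ker

/-- The Jacobian of a graph: divisor classes of degree zero. -/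
noncomputable abbrev Jac (G : SimpleGraph V) : Type _ :=
  Deg0 V ⧸ ((Principal G).addSubgroupOf (Deg0 V))

/-- The number of connected components of the spanning subgraph with edge set `A`. -/
noncomputable def numComponents (V : Type) [Fintype V] (A : Set (Sym2 V)) : ℕ :=
  Nat.card (SimpleGraph.fromEdgeSet A).ConnectedComponent

/-- The number of edges of a graph. -/
noncomputable def edgeCount (G : SimpleGraph V) : ℕ := Nat.card G.edgeSet

open MvPolynomial in
/-- The Tutte polynomial of `G`, as a polynomial in `ℤ[x, y]` with `x = X 0`, `y = X 1`:
`T_G(x,y) = Σ_{A ⊆ E(G)} (x−1)^(c(A)−c(E(G))) (y−1)^(c(A)+|A|−|V(G)|)`. -/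
noncomputable def tutte (G : SimpleGraph V) : MvPolynomial (Fin 2) ℤ :=
  ∑ A ∈ G.edgeFinset.powerset,
    (X 0 - 1) ^ (numComponents V ↑A - numComponents V G.edgeSet) *
    (X 1 - 1) ^ (numComponents V ↑A + A.card - Fintype.card V)


/-! ### Generic theory: divisor classes via a finite group model -/

section Model

variable {A : Type} [AddCommGroup A] (a : Fin 8 → A)

/-- `Wp a d x`: the class of degree `d` with Jacobian coordinate `x` is winnable. -/
def Wp : ℕ → A → Prop
  | 0, x => x = 0
  | d + 1, x => ∃ v, Wp d (x - a v)

/-- `Rp a d0 k x`: the class of degree `d0 + k` with coordinate `x` has rank at least `k`. -/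
def Rp (d0 : ℕ) : ℕ → A → Prop
  | 0, x => Wp a d0 x
  | k + 1, x => ∀ v, Rp d0 k (x - a v)

theorem Rp_iff (d0 k : ℕ) (x : A) :
    Rp a d0 k x ↔ ∀ y, Wp a k y → Wp a d0 (x - y) := by
  induction k generalizing x with
  | zero => simp [Rp, Wp]
  | succ k ih =>
    simp only [Rp, Wp, ih]
    constructor
    · rintro h y ⟨v, hv⟩
      have := h v _ hv
      rwa [sub_sub_sub_cancel_right] at this
    · intro h v y hy
      have := h (y + a v) ⟨v, by simpa using hy⟩
      rwa [add_comm, ← sub_sub] at this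

variable {a}

theorem Wp_succ (h0 : a 0 = 0) {d : ℕ} {x : A} (h : Wp a d x) : Wp a (d + 1) x :=
  ⟨0, by simpa [h0] using h⟩

theorem Wp_mono (h0 : a 0 = 0) {d e : ℕ} (hde : d ≤ e) {x : A} (h : Wp a d x) : Wp a e x := by
  induction hde with
  | refl => exact h
  | step _ ih => exact Wp_succ h0 ih

theorem Rp_down (d0 k : ℕ) (x : A) (h : Rp a d0 (k + 1) x) : Rp a (d0 + 1) k x := by
  induction k generalizing x with
  | zero => exact ⟨0, h 0⟩
  | succ k ih => exact fun v => ih _ (h v)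

/-- Classes of degree `d` with rank at least `k`. -/
def Qp (a : Fin 8 → A) (d k : ℕ) (x : A) : Prop := k ≤ d ∧ Rp a (d - k) k x

theorem Qp_down (d k : ℕ) (x : A) (h : Qp a d (k + 1) x) : Qp a d k x := by
  obtain ⟨h1, h2⟩ := h
  refine ⟨by omega, ?_⟩
  have := Rp_down _ _ _ h2
  rwa [show d - (k + 1) + 1 = d - k by omega] at this

theorem Qp_anti (d : ℕ) {k l : ℕ} (hkl : k ≤ l) (x : A) (h : Qp a d l x) : Qp a d k x := by
  induction hkl with
  | refl => exact h
  | step _ ih => exact ih (Qp_down _ _ _ h)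

theorem Qp_large (h0 : a 0 = 0) (h5 : ∀ x, Wp a 5 x) (h4 : ∃ x, ¬ Wp a 4 x)
    (d k : ℕ) (hd : 9 ≤ d) (x : A) : Qp a d k x ↔ k + 5 ≤ d := by
  constructor
  · rintro ⟨h1, h2⟩
    by_contra hlt
    obtain ⟨z, hz⟩ := h4
    rw [Rp_iff] at h2
    have := h2 (x - z) (Wp_mono h0 (by omega : 5 ≤ k) (h5 _))
    rw [sub_sub_cancel] at this
    exact hz (Wp_mono h0 (by omega) this)
  · intro h
    refine ⟨by omega, ?_⟩
    rw [Rp_iff]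
    intro y _
    exact Wp_mono h0 (by omega : 5 ≤ d - k) (h5 _)

end Model

theorem degSum_add (D E : V → ℤ) : degSum (D + E) = degSum D + degSum E := by
  simp [degSum, Finset.sum_add_distrib]

theorem degSum_sub (D E : V → ℤ) : degSum (D - E) = degSum D - degSum E := by
  simp [degSum, Finset.sum_sub_distrib]

theorem degSum_single (v : Fin 8) (c : ℤ) : degSum (Pi.single v c : Fin 8 → ℤ) = c := by
  simp [degSum]

theorem degSum_nonneg {E : V → ℤ} (h : Effective E) : 0 ≤ degSum E :=
  Finset.sum_nonneg fun v _ => h v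

/-- A model of the Picard group of `G` as `A × ℤ`. -/
structure PicModel (G : SimpleGraph (Fin 8)) (A : Type) [AddCommGroup A] where
  ψ : (Fin 8 → ℤ) →+ A
  ker : ∀ D, D ∈ Principal G ↔ degSum D = 0 ∧ ψ D = 0
  zero : ψ (Pi.single 0 1) = 0
  surj : ∀ x, ∃ D, ψ D = x

section PicModel

variable {A : Type} [AddCommGroup A] {G : SimpleGraph (Fin 8)}

/-- The image of the vertices. -/
def PicModel.a (M : PicModel G A) (v : Fin 8) : A := M.ψ (Pi.single v 1)

theorem PicModel.surj' (M : PicModel G A) (d : ℤ) (x : A) : ∃ D, degSum D = d ∧ M.ψ D = x := by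
  obtain ⟨D, hD⟩ := M.surj x
  refine ⟨D + Pi.single 0 (d - degSum D), ?_, ?_⟩
  · rw [degSum_add, degSum_single]; ring
  · have : (Pi.single 0 (d - degSum D) : Fin 8 → ℤ) = (d - degSum D) • Pi.single 0 1 := by
      rw [← Pi.single_smul]; simp
    rw [map_add, this, map_zsmul, M.zero, hD]; simp

theorem PicModel.eff_iff (M : PicModel G A) (d : ℕ) (x : A) :
    (∃ E, Effective E ∧ degSum E = d ∧ M.ψ E = x) ↔ Wp M.a d x := by
  induction d generalizing x with
  | zero =>
    constructor
    · rintro ⟨E, h1, h2, h3⟩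
      have : E = 0 := by
        funext v
        have := (Finset.sum_eq_zero_iff_of_nonneg (fun v _ => h1 v)).1 h2 v (Finset.mem_univ v)
        simpa using this
      subst this
      simpa [Wp] using h3.symm
    · intro h
      exact ⟨0, fun v => le_refl _, by simp [degSum], by simpa [Wp] using h.symm⟩
  | succ d ih =>
    simp only [Wp, ← ih]
    constructor
    · rintro ⟨E, h1, h2, h3⟩
      obtain ⟨v, hv⟩ : ∃ v, 0 < E v := by
        by_contra hcon
        push Not at hcon
        have : degSum E ≤ 0 := Finset.sum_nonpos fun v _ => hcon v
        push_cast at h2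
        omega
      refine ⟨v, E - Pi.single v 1, ?_, ?_, ?_⟩
      · intro w
        by_cases hw : w = v
        · subst hw; simp; omega
        · simpa [hw] using h1 w
      · rw [degSum_sub, degSum_single, h2]; push_cast; ring
      · rw [map_sub, h3]; rfl
    · rintro ⟨v, E, h1, h2, h3⟩
      refine ⟨E + Pi.single v 1, ?_, ?_, ?_⟩
      · intro w
        by_cases hw : w = v
        · subst hw; have := h1 w; simp; omega
        · simpa [hw] using h1 w
      · rw [degSum_add, degSum_single, h2]; push_cast; ring
      · rw [map_add, h3]; exact sub_add_cancel _ _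

theorem PicModel.linEquiv_iff (M : PicModel G A) (D E : Fin 8 → ℤ) :
    LinEquiv G D E ↔ degSum E = degSum D ∧ M.ψ E = M.ψ D := by
  unfold LinEquiv
  rw [M.ker, degSum_sub, map_sub, sub_eq_zero, sub_eq_zero, eq_comm, @eq_comm _ (M.ψ D)]

theorem PicModel.winnable_iff (M : PicModel G A) (D : Fin 8 → ℤ) (d : ℕ) (hd : degSum D = d) :
    Winnable G D ↔ Wp M.a d (M.ψ D) := by
  rw [← M.eff_iff]
  unfold Winnable
  simp only [M.linEquiv_iff, hd]

theorem PicModel.not_winnable (M : PicModel G A) (D : Fin 8 → ℤ) (hd : degSum D < 0) : ¬ Winnable G D := by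
  rintro ⟨E, h1, h2⟩
  rw [M.linEquiv_iff] at h2
  have := degSum_nonneg h1
  omega

theorem PicModel.rank_ge_iff (M : PicModel G A) (D : Fin 8 → ℤ) (k : ℕ) :
    (∀ E : Fin 8 → ℤ, Effective E → degSum E = k → Winnable G (D - E)) ↔
      ∃ d : ℕ, degSum D = d ∧ Qp M.a d k (M.ψ D) := by
  constructor
  · intro h
    have hk : (k : ℤ) ≤ degSum D := by
      by_contra hlt
      have h1 : Effective (Pi.single 0 (k : ℤ) : Fin 8 → ℤ) := by
        intro w
        by_cases hw : w = 0
        · subst hw; simp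
        · simp [hw]
      refine M.not_winnable _ ?_ (h _ h1 (degSum_single _ _))
      rw [degSum_sub, degSum_single]; omega
    obtain ⟨d, hd⟩ := Int.eq_ofNat_of_zero_le (le_trans (Int.natCast_nonneg k) hk)
    refine ⟨d, hd, by omega, ?_⟩
    rw [Rp_iff]
    intro y hy
    obtain ⟨E, h1, h2, rfl⟩ := (M.eff_iff k y).2 hy
    rw [← map_sub, ← M.winnable_iff]
    · exact h E h1 h2
    · rw [degSum_sub]; omega
  · rintro ⟨d, hd, hkd, h⟩ E h1 h2
    rw [Rp_iff] at h
    rw [M.winnable_iff _ (d - k), map_sub]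
    · exact h _ ((M.eff_iff k _).1 ⟨E, h1, h2, rfl⟩)
    · rw [degSum_sub]; omega

/-- The set whose supremum is the rank. -/
def rankSet (G : SimpleGraph (Fin 8)) (D : Fin 8 → ℤ) : Set ℤ :=
  {r : ℤ | r = -1 ∨ (0 ≤ r ∧
    ∀ E : Fin 8 → ℤ, Effective E → degSum E = r → Winnable G (D - E))}

theorem PicModel.mem_rankSet (M : PicModel G A) (D : Fin 8 → ℤ) (k : ℕ) :
    (k : ℤ) ∈ rankSet G D ↔ ∃ d : ℕ, degSum D = d ∧ Qp M.a d k (M.ψ D) := by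
  rw [← M.rank_ge_iff]
  unfold rankSet
  simp only [Set.mem_ofPred_eq]
  constructor
  · rintro (h | h)
    · omega
    · exact h.2
  · intro h
    exact Or.inr ⟨by omega, h⟩

theorem PicModel.bddAbove (M : PicModel G A) (D : Fin 8 → ℤ) : BddAbove (rankSet G D) := by
  refine ⟨max (-1) (degSum D), ?_⟩
  intro r hr
  rcases lt_or_ge r 0 with h | h
  · rcases hr with rfl | h'
    · simp
    · omega
  · obtain ⟨k, rfl⟩ := Int.eq_ofNat_of_zero_le h
    obtain ⟨d, hd, hk, _⟩ := (M.mem_rankSet D k).1 hr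
    apply le_max_of_le_right
    omega

theorem PicModel.mem_bnRank (M : PicModel G A) (D : Fin 8 → ℤ) : bnRank G D ∈ rankSet G D :=
  Int.csSup_mem ⟨-1, Or.inl rfl⟩ (M.bddAbove D)

theorem PicModel.le_bnRank (M : PicModel G A) (D : Fin 8 → ℤ) (r : ℤ) (h : r ∈ rankSet G D) : r ≤ bnRank G D :=
  le_csSup (M.bddAbove D) h

theorem PicModel.neg_one_le (M : PicModel G A) (D : Fin 8 → ℤ) : -1 ≤ bnRank G D :=
  M.le_bnRank D _ (Or.inl rfl)

theorem PicModel.le_bnRank_iff (M : PicModel G A) (D : Fin 8 → ℤ) (d : ℕ) (hd : degSum D = d) (k : ℕ) :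
    (k : ℤ) ≤ bnRank G D ↔ Qp M.a d k (M.ψ D) := by
  constructor
  · intro h
    have h1 := M.mem_bnRank D
    obtain ⟨l, hl⟩ := Int.eq_ofNat_of_zero_le (le_trans (Int.natCast_nonneg k) h)
    rw [hl, M.mem_rankSet] at h1
    obtain ⟨d', hd', h2⟩ := h1
    have : d' = d := by omega
    subst this
    exact Qp_anti _ (by omega) _ h2
  · intro h
    exact M.le_bnRank D _ ((M.mem_rankSet D k).2 ⟨d, hd, h⟩)

theorem PicModel.bnRank_neg (M : PicModel G A) (D : Fin 8 → ℤ) (hd : degSum D < 0) : bnRank G D = -1 := by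
  rcases lt_or_ge (bnRank G D) 0 with h | h
  · have := M.neg_one_le D; omega
  · exfalso
    obtain ⟨l, hl⟩ := Int.eq_ofNat_of_zero_le h
    have h1 := M.mem_bnRank D
    rw [hl, M.mem_rankSet] at h1
    obtain ⟨d', hd', h2⟩ := h1
    omega

/-- Number of classes with given degree satisfying a predicate, transported to the model. -/
theorem PicModel.numClasses_eq (M : PicModel G A) (d r : ℤ) (P : A → Prop)
    (hP : ∀ D : Fin 8 → ℤ, degSum D = d → (bnRank G D = r ↔ P (M.ψ D))) :
    numClasses G d r = Set.ncard {x : A | P x} := by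
  unfold numClasses
  symm
  have key : ∀ D E : Fin 8 → ℤ, degSum D = d → degSum E = d →
      (M.ψ D = M.ψ E ↔ QuotientAddGroup.mk' (Principal G) D
        = QuotientAddGroup.mk' (Principal G) E) := by
    intro D E hD hE
    rw [QuotientAddGroup.mk'_eq_mk', ]
    constructor
    · intro h
      refine ⟨E - D, ?_, by abel⟩
      rw [M.ker, degSum_sub, map_sub, h, hD, hE]
      simp
    · rintro ⟨z, hz, rfl⟩
      rw [M.ker] at hz
      rw [map_add, hz.2, add_zero]
  choose s hs1 hs2 using M.surj' d
  refine Set.ncard_congr (fun x _ => QuotientAddGroup.mk' (Principal G) (s x)) ?_ ?_ ?_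
  · intro x hx
    refine ⟨s x, rfl, hs1 x, ?_⟩
    rw [hP _ (hs1 x), hs2]
    exact hx
  · intro x y _ _ h
    rw [← key _ _ (hs1 x) (hs1 y), hs2, hs2] at h
    exact h
  · rintro c ⟨D, rfl, hD, hr⟩
    refine ⟨M.ψ D, (hP D hD).1 hr, ?_⟩
    rw [← key _ _ (hs1 _) hD, hs2]

theorem PicModel.numClasses_neg (M : PicModel G A) (d r : ℤ) (hd : d < 0) :
    numClasses G d r = if r = -1 then Nat.card A else 0 := by
  rw [M.numClasses_eq d r (fun _ => r = -1)]
  · split_ifs with h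
    · simp [h, Set.ncard_univ]
    · simp [h]
  · intro D hD
    rw [M.bnRank_neg D (by omega), eq_comm]

theorem PicModel.numClasses_lt (M : PicModel G A) (d r : ℤ) (hr : r < -1) : numClasses G d r = 0 := by
  rw [M.numClasses_eq d r (fun _ => False)]
  · simp
  · intro D hD
    have := M.neg_one_le D
    constructor
    · intro h; omega
    · exact False.elim

theorem PicModel.numClasses_neg_one (M : PicModel G A) [Finite A] (d : ℕ) :
    numClasses G d (-1) = Nat.card A - Set.ncard {x : A | Qp M.a d 0 x} := by
  rw [M.numClasses_eq d (-1) (fun x => ¬ Qp M.a d 0 x)]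
  · rw [← Set.ncard_compl]; rfl
  · intro D hD
    rw [← M.le_bnRank_iff D d hD]
    have := M.neg_one_le D
    push_cast
    omega

theorem PicModel.numClasses_nat (M : PicModel G A) [Finite A] (d k : ℕ) :
    numClasses G d k = Set.ncard {x : A | Qp M.a d k x} -
      Set.ncard {x : A | Qp M.a d (k + 1) x} := by
  rw [M.numClasses_eq d k (fun x => Qp M.a d k x ∧ ¬ Qp M.a d (k + 1) x)]
  · have hsub : {x : A | Qp M.a d (k + 1) x} ⊆ {x : A | Qp M.a d k x} :=
      fun x hx => Qp_down _ _ _ hx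
    rw [← Set.ncard_sdiff hsub]; rfl
  · intro D hD
    rw [← M.le_bnRank_iff D d hD, ← M.le_bnRank_iff D d hD]
    push_cast
    omega

theorem sameZeta_of_models (M : PicModel G A) {B : Type} [AddCommGroup B] {H : SimpleGraph (Fin 8)}
    [Finite A] [Finite B] (N : PicModel H B) (hc : Nat.card A = Nat.card B)
    (h5 : ∀ x, Wp M.a 5 x) (h4 : ∃ x, ¬ Wp M.a 4 x)
    (h5' : ∀ x, Wp N.a 5 x) (h4' : ∃ x, ¬ Wp N.a 4 x)
    (htab : ∀ d0 k : ℕ, d0 + k < 9 →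
      Set.ncard {x : A | Rp M.a d0 k x} = Set.ncard {x : B | Rp N.a d0 k x}) :
    SameZeta G H := by
  have hQ : ∀ d k : ℕ,
      Set.ncard {x : A | Qp M.a d k x} = Set.ncard {x : B | Qp N.a d k x} := by
    intro d k
    rcases lt_or_ge d 9 with hd | hd
    · by_cases hk : k ≤ d
      · have := htab (d - k) k (by omega)
        simpa [Qp, hk] using this
      · simp [Qp, hk]
    · simp only [Qp_large M.zero h5 h4 d k hd, Qp_large N.zero h5' h4' d k hd]
      by_cases hk : k + 5 ≤ d
      · simp [hk, Set.ncard_univ, hc]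
      · simp [hk]
  intro d r
  rcases lt_or_ge d 0 with hd | hd
  · rw [M.numClasses_neg d r hd, N.numClasses_neg d r hd, hc]
  · obtain ⟨d, rfl⟩ := Int.eq_ofNat_of_zero_le hd
    rcases lt_trichotomy r (-1) with hr | rfl | hr
    · rw [M.numClasses_lt _ r hr, N.numClasses_lt _ r hr]
    · rw [M.numClasses_neg_one, N.numClasses_neg_one, hQ, hc]
    · obtain ⟨k, rfl⟩ := Int.eq_ofNat_of_zero_le (show 0 ≤ r by omega)
      rw [M.numClasses_nat, N.numClasses_nat, hQ, hQ]

theorem PicModel.jac (M : PicModel G A) : Nonempty (Jac G ≃+ A) := by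
  let f : Deg0 (Fin 8) →+ A := M.ψ.comp (Deg0 (Fin 8)).subtype
  have hf : Function.Surjective f := by
    intro x
    obtain ⟨D, hD, hx⟩ := M.surj' 0 x
    exact ⟨⟨D, hD⟩, hx⟩
  have hk : (Principal G).addSubgroupOf (Deg0 (Fin 8)) = f.ker := by
    ext ⟨D, hD⟩
    have hD' : degSum D = 0 := hD
    rw [AddSubgroup.mem_addSubgroupOf, M.ker, AddMonoidHom.mem_ker]
    exact ⟨fun h => h.2, fun h => ⟨hD', h⟩⟩
  exact ⟨(QuotientAddGroup.quotientAddEquivOfEq hk).trans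
    (QuotientAddGroup.quotientKerEquivOfSurjective f hf)⟩

end PicModel

/-! ### Bitmask computation of the rank tables -/

/-- Kernel-friendly strict evaluation: `force n f = f n`. -/
def force {α : Type} (n : ℕ) (f : ℕ → α) : α :=
  Nat.rec (f 0) (fun k _ => f (k + 1)) n

theorem force_eq {α : Type} (n : ℕ) (f : ℕ → α) : force n f = f n := by
  cases n <;> rfl

/-- Bitmask of a predicate. -/
def mkMask (p : ℕ → Bool) : ℕ → ℕ
  | 0 => 0
  | n + 1 => mkMask p n ||| (bif p n then 1 <<< n else 0)

theorem testBit_mkMask (p : ℕ → Bool) (n i : ℕ) :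
    (mkMask p n).testBit i = (decide (i < n) && p i) := by
  induction n with
  | zero => simp [mkMask]
  | succ n ih =>
    rw [mkMask, Nat.testBit_or, ih]
    rcases lt_trichotomy i n with h | rfl | h
    · have h1 : i < n + 1 := by omega
      cases hp : p n <;> simp [h, h1, Nat.testBit_shiftLeft]
    · cases hp : p i <;> simp [Nat.testBit_shiftLeft]
    · have h1 : ¬ i < n + 1 := by omega
      have h2 : ¬ i < n := by omega
      cases hp : p n
      · simp [h1, h2]
      · have h3 : i - n ≠ 0 := by omega
        have h4 : Nat.testBit 1 (i - n) = false := by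
          rw [Bool.eq_false_iff]
          exact fun h' => h3 (Nat.testBit_one_eq_true_iff_self_eq_zero.1 h')
        simp [h1, h2, Nat.testBit_shiftLeft, h4]

/-- Translation in the group `ZMod m × ZMod n`, with elements coded as numbers below `m * n`. -/
def subCode (m n x y i : ℕ) : ℕ := (i / n + (m - x)) % m * n + (i % n + (n - y)) % n

def anyL (m n M i : ℕ) : List (ℕ × ℕ) → Bool
  | [] => false
  | e :: l => M.testBit (subCode m n e.1 e.2 i) || anyL m n M i l

def allL (m n M i : ℕ) : List (ℕ × ℕ) → Bool
  | [] => true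
  | e :: l => M.testBit (subCode m n e.1 e.2 i) && allL m n M i l

theorem anyL_iff (m n M i : ℕ) (l : List (ℕ × ℕ)) :
    anyL m n M i l = true ↔ ∃ e ∈ l, M.testBit (subCode m n e.1 e.2 i) = true := by
  induction l with
  | nil => simp [anyL]
  | cons e l ih => simp [anyL, ih]

theorem allL_iff (m n M i : ℕ) (l : List (ℕ × ℕ)) :
    allL m n M i l = true ↔ ∀ e ∈ l, M.testBit (subCode m n e.1 e.2 i) = true := by
  induction l with
  | nil => simp [allL]
  | cons e l ih => simp [allL, ih]

def stepW (m n : ℕ) (l : List (ℕ × ℕ)) (M : ℕ) : ℕ :=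
  force M fun M => mkMask (fun i => anyL m n M i l) (m * n)

def stepR (m n : ℕ) (l : List (ℕ × ℕ)) (M : ℕ) : ℕ :=
  force M fun M => mkMask (fun i => allL m n M i l) (m * n)

def maskW (m n : ℕ) (l : List (ℕ × ℕ)) : ℕ → ℕ
  | 0 => 1
  | d + 1 => stepW m n l (maskW m n l d)

def maskR (m n : ℕ) (l : List (ℕ × ℕ)) (d0 : ℕ) : ℕ → ℕ
  | 0 => maskW m n l d0
  | k + 1 => stepR m n l (maskR m n l d0 k)

def cnt (M : ℕ) : ℕ → ℕ
  | 0 => 0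
  | n + 1 => cnt M n + bif M.testBit n then 1 else 0

theorem cnt_eq (M n : ℕ) : cnt M n = ((Finset.range n).filter fun i => M.testBit i = true).card := by
  induction n with
  | zero => simp [cnt]
  | succ n ih =>
    rw [cnt, ih, Finset.range_add_one, Finset.filter_insert]
    cases h : M.testBit n <;> simp

/-- Decode a number below `m * n`. -/
def dec (m n i : ℕ) : ZMod m × ZMod n := (((i / n : ℕ) : ZMod m), ((i : ℕ) : ZMod n))

theorem subCode_lt (m n x y i : ℕ) (hm : 0 < m) (hn : 0 < n) : subCode m n x y i < m * n := by
  unfold subCode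
  have h1 := Nat.mod_lt (i / n + (m - x)) hm
  have h2 := Nat.mod_lt (i % n + (n - y)) hn
  calc _ < (i / n + (m - x)) % m * n + n := by omega
    _ = ((i / n + (m - x)) % m + 1) * n := by ring
    _ ≤ m * n := Nat.mul_le_mul_right _ h1

theorem dec_subCode (m n x y i : ℕ) (hn : 0 < n) (hx : x ≤ m) (hy : y ≤ n) :
    dec m n (subCode m n x y i) = dec m n i - ((x : ZMod m), (y : ZMod n)) := by
  have h2 := Nat.mod_lt (i % n + (n - y)) hn
  unfold dec subCode
  ext
  · simp only [Prod.fst_sub]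
    rw [Nat.add_div_of_dvd_right (Dvd.intro_left _ rfl), Nat.mul_div_cancel _ hn,
      Nat.div_eq_of_lt h2, add_zero, ZMod.natCast_mod, Nat.cast_add, Nat.cast_sub hx]
    simp [sub_eq_add_neg]
  · simp only [Prod.snd_sub]
    rw [Nat.cast_add, Nat.cast_mul, ZMod.natCast_mod, Nat.cast_add, ZMod.natCast_mod,
      Nat.cast_sub hy]
    simp [sub_eq_add_neg]

theorem dec_bij (m n : ℕ) [NeZero m] [NeZero n] :
    Function.Bijective (fun i : Fin (m * n) => dec m n i) := by
  rw [Fintype.bijective_iff_surjective_and_card]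
  constructor
  · rintro ⟨x, y⟩
    have h1 := ZMod.val_lt x
    have h2 := ZMod.val_lt y
    have hn : 0 < n := Nat.pos_of_neZero n
    refine ⟨⟨x.val * n + y.val, ?_⟩, ?_⟩
    · calc _ < x.val * n + n := by omega
        _ = (x.val + 1) * n := by ring
        _ ≤ m * n := Nat.mul_le_mul_right _ h1
    · simp only [dec]
      rw [Nat.add_div_of_dvd_right (Dvd.intro_left _ rfl), Nat.mul_div_cancel _ hn,
        Nat.div_eq_of_lt h2]
      simp
  · simp [ZMod.card]

theorem dec_inj (m n : ℕ) [NeZero m] [NeZero n] {i j : ℕ} (hi : i < m * n) (hj : j < m * n)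
    (h : dec m n i = dec m n j) : i = j := by
  have := (dec_bij m n).1 (a₁ := ⟨i, hi⟩) (a₂ := ⟨j, hj⟩) h
  simpa using this

section Correct

variable (m n : ℕ) [NeZero m] [NeZero n] (l : List (ℕ × ℕ)) (a : Fin 8 → ZMod m × ZMod n)

/-- The list `l` codes the vertex images `a`. -/
def Codes : Prop :=
  (∀ e ∈ l, e.1 ≤ m ∧ e.2 ≤ n) ∧
  (∀ v, ∃ e ∈ l, a v = ((e.1 : ZMod m), (e.2 : ZMod n))) ∧
  (∀ e ∈ l, ∃ v, a v = ((e.1 : ZMod m), (e.2 : ZMod n)))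

variable {m n l a}

theorem maskW_iff (hc : Codes m n l a) (d i : ℕ) (hi : i < m * n) :
    (maskW m n l d).testBit i = true ↔ Wp a d (dec m n i) := by
  have hm : 0 < m := Nat.pos_of_neZero m
  have hn : 0 < n := Nat.pos_of_neZero n
  obtain ⟨hc1, hc2, hc3⟩ := hc
  induction d generalizing i with
  | zero =>
    have h0 : dec m n 0 = 0 := by simp [dec]
    simp only [maskW, Wp]
    rw [← h0, Nat.testBit_one_eq_true_iff_self_eq_zero]
    exact ⟨fun h => by rw [h], fun h => dec_inj m n hi (Nat.mul_pos hm hn) h⟩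
  | succ d ih =>
    simp only [maskW, stepW, force_eq, Wp]
    rw [testBit_mkMask]
    simp only [hi, decide_true, Bool.true_and]
    rw [anyL_iff]
    constructor
    · rintro ⟨e, he, h⟩
      have hiff := propext (ih (subCode m n e.1 e.2 i) (subCode_lt m n e.1 e.2 i hm hn))
      rw [hiff, dec_subCode _ _ _ _ _ hn (hc1 e he).1 (hc1 e he).2] at h
      obtain ⟨v, hv⟩ := hc3 e he
      exact ⟨v, by rwa [hv]⟩
    · rintro ⟨v, h⟩
      obtain ⟨e, he, hv⟩ := hc2 v
      refine ⟨e, he, ?_⟩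
      have hiff := propext (ih (subCode m n e.1 e.2 i) (subCode_lt m n e.1 e.2 i hm hn))
      rw [hiff, dec_subCode _ _ _ _ _ hn (hc1 e he).1 (hc1 e he).2, ← hv]
      exact h

theorem maskR_iff (hc : Codes m n l a) (d0 k i : ℕ) (hi : i < m * n) :
    (maskR m n l d0 k).testBit i = true ↔ Rp a d0 k (dec m n i) := by
  have hm : 0 < m := Nat.pos_of_neZero m
  have hn : 0 < n := Nat.pos_of_neZero n
  have hc' := hc
  obtain ⟨hc1, hc2, hc3⟩ := hc
  induction k generalizing i with
  | zero => exact maskW_iff hc' d0 i hi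
  | succ d ih =>
    simp only [maskR, stepR, force_eq, Rp]
    rw [testBit_mkMask]
    simp only [hi, decide_true, Bool.true_and]
    rw [allL_iff]
    constructor
    · intro h v
      obtain ⟨e, he, hv⟩ := hc2 v
      have := h e he
      have hiff := propext (ih (subCode m n e.1 e.2 i) (subCode_lt m n e.1 e.2 i hm hn))
      rw [hiff, dec_subCode _ _ _ _ _ hn (hc1 e he).1 (hc1 e he).2] at this
      rwa [hv]
    · intro h e he
      obtain ⟨v, hv⟩ := hc3 e he
      have hiff := propext (ih (subCode m n e.1 e.2 i) (subCode_lt m n e.1 e.2 i hm hn))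
      rw [hiff, dec_subCode _ _ _ _ _ hn (hc1 e he).1 (hc1 e he).2, ← hv]
      exact h v

theorem ncard_Rp (hc : Codes m n l a) (d0 k : ℕ) :
    Set.ncard {x | Rp a d0 k x} = cnt (maskR m n l d0 k) (m * n) := by
  rw [cnt_eq, ← Set.ncard_coe_finset]
  symm
  refine Set.ncard_congr (fun i _ => dec m n i) ?_ ?_ ?_
  · intro i hi
    simp only [Finset.coe_filter, Finset.mem_range] at hi
    exact (maskR_iff hc d0 k i hi.1).1 hi.2
  · intro i j hi hj h
    simp only [Finset.coe_filter, Finset.mem_range] at hi hj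
    exact dec_inj m n hi.1 hj.1 h
  · intro x hx
    obtain ⟨⟨i, hi⟩, rfl⟩ := (dec_bij m n).2 x
    refine ⟨i, ?_, rfl⟩
    simp only [Finset.coe_filter, Finset.mem_range]
    exact ⟨hi, (maskR_iff hc d0 k i hi).2 hx⟩

theorem card_model : Nat.card (ZMod m × ZMod n) = m * n := by
  simp

theorem all_W (hc : Codes m n l a) (d : ℕ) (h : cnt (maskW m n l d) (m * n) = m * n) :
    ∀ x, Wp a d x := by
  have h1 := ncard_Rp hc d 0
  rw [maskR, h, ← card_model, ] at h1
  have h2 := Set.eq_univ_iff_ncard _ |>.2 h1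
  intro x
  have : x ∈ {x | Rp a d 0 x} := by rw [h2]; trivial
  exact this

theorem not_all_W (hc : Codes m n l a) (d : ℕ) (h : cnt (maskW m n l d) (m * n) ≠ m * n) :
    ∃ x, ¬ Wp a d x := by
  by_contra hcon
  push Not at hcon
  have h1 := ncard_Rp hc d 0
  have h2 : {x | Rp a d 0 x} = Set.univ := Set.eq_univ_of_forall hcon
  rw [h2, Set.ncard_univ, card_model] at h1
  exact h h1.symm

end Correct

/-- Compare the rank rows of two graphs. -/
def chkR (m n : ℕ) (l : List (ℕ × ℕ)) (m' n' : ℕ) (l' : List (ℕ × ℕ)) : ℕ → ℕ → ℕ → Bool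
  | 0, _, _ => true
  | j + 1, M, M' => force M fun M => force M' fun M' =>
      Nat.beq (cnt M (m * n)) (cnt M' (m' * n')) &&
        chkR m n l m' n' l' j (stepR m n l M) (stepR m' n' l' M')

def chkW (m n : ℕ) (l : List (ℕ × ℕ)) (m' n' : ℕ) (l' : List (ℕ × ℕ)) : ℕ → ℕ → ℕ → Bool
  | 0, _, _ => true
  | j + 1, M, M' => force M fun M => force M' fun M' =>
      chkR m n l m' n' l' (j + 1) M M' &&
        chkW m n l m' n' l' j (stepW m n l M) (stepW m' n' l' M')

section Check

variable (m n : ℕ) (l : List (ℕ × ℕ)) (m' n' : ℕ) (l' : List (ℕ × ℕ))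

theorem chkR_spec (d0 j i : ℕ)
    (h : chkR m n l m' n' l' j (maskR m n l d0 i) (maskR m' n' l' d0 i) = true)
    (k : ℕ) (h1 : i ≤ k) (h2 : k < i + j) :
    cnt (maskR m n l d0 k) (m * n) = cnt (maskR m' n' l' d0 k) (m' * n') := by
  induction j generalizing i with
  | zero => omega
  | succ j ih =>
    simp only [chkR, force_eq, Bool.and_eq_true] at h
    rcases Nat.eq_or_lt_of_le h1 with rfl | h3
    · exact Nat.eq_of_beq_eq_true h.1
    · exact ih (i + 1) h.2 h3 (by omega)

theorem chkW_spec (j i : ℕ)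
    (h : chkW m n l m' n' l' j (maskW m n l i) (maskW m' n' l' i) = true)
    (d0 k : ℕ) (h1 : i ≤ d0) (h2 : d0 + k < i + j) :
    cnt (maskR m n l d0 k) (m * n) = cnt (maskR m' n' l' d0 k) (m' * n') := by
  induction j generalizing i with
  | zero => omega
  | succ j ih =>
    simp only [chkW, force_eq, Bool.and_eq_true] at h
    rcases Nat.eq_or_lt_of_le h1 with rfl | h3
    · exact chkR_spec m n l m' n' l' i (j + 1) 0 h.1 k (by omega) (by omega)
    · exact ih (i + 1) h.2 h3 (by omega)

end Check

def aG : List (ℕ × ℕ) := [(0, 0), (0, 1), (1, 0), (22, 5), (31, 1), (17, 4), (3, 5), (20, 4)]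

def aH : List (ℕ × ℕ) :=
  [(0, 0), (154, 0), (1, 0), (14, 0), (152, 0), (282, 0), (43, 0), (257, 0)]

set_option maxRecDepth 100000 in
theorem check_tables : chkW 42 7 aG 294 1 aH 9 1 1 = true := by decide +kernel

set_option maxRecDepth 100000 in
theorem check_W5 : cnt (maskW 42 7 aG 5) 294 = 294 := by decide +kernel

set_option maxRecDepth 100000 in
theorem check_W4 : cnt (maskW 42 7 aG 4) 294 = 202 := by decide +kernel

/-! ### Component counting and the Tutte polynomial -/

/-- Octal digit `v` of `s`: the label of vertex `v`. -/
def dig (s v : ℕ) : ℕ := s / 8 ^ v % 8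

def rl (x y d : ℕ) : ℕ := bif Nat.beq d y then x else d

def mergeCode (s x y : ℕ) : ℕ :=
  rl x y (dig s 0) + 8 * rl x y (dig s 1) + 8 ^ 2 * rl x y (dig s 2) + 8 ^ 3 * rl x y (dig s 3)
  + 8 ^ 4 * rl x y (dig s 4) + 8 ^ 5 * rl x y (dig s 5) + 8 ^ 6 * rl x y (dig s 6)
  + 8 ^ 7 * rl x y (dig s 7)

/-- Generating number of all subsets of the edge list, coded base `8192`. -/
def go : List (ℕ × ℕ) → ℕ → ℕ → ℕ → ℕ
  | [], _, c, k => 8192 ^ (16 * c + k)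
  | e :: es, s, c, k => force s fun s => go es s c k +
      bif Nat.beq (dig s e.1) (dig s e.2) then go es s c (k + 1)
      else go es (mergeCode s (dig s e.1) (dig s e.2)) (c - 1) (k + 1)

def s0 : ℕ := 0 + 8 * 1 + 8 ^ 2 * 2 + 8 ^ 3 * 3 + 8 ^ 4 * 4 + 8 ^ 5 * 5 + 8 ^ 6 * 6 + 8 ^ 7 * 7

theorem dig_lt (s v : ℕ) : dig s v < 8 := Nat.mod_lt _ (by norm_num)

theorem rl_eq (x y d : ℕ) : rl x y d = if d = y then x else d := by
  unfold rl
  by_cases h : d = y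
  · simp [h]
  · have : Nat.beq d y = false := by
      rw [Bool.eq_false_iff]
      exact fun h' => h (Nat.eq_of_beq_eq_true h')
    simp [h, this]

theorem dig_mergeCode (s x y : ℕ) (hx : x < 8) (v : Fin 8) :
    dig (mergeCode s x y) v = if dig s v = y then x else dig s v := by
  rw [← rl_eq]
  have h : ∀ w, rl x y (dig s w) < 8 := by
    intro w
    rw [rl_eq]
    have := dig_lt s w
    split_ifs <;> omega
  have h0 := h 0
  have h1 := h 1
  have h2 := h 2
  have h3 := h 3
  have h4 := h 4
  have h5 := h 5
  have h6 := h 6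
  have h7 := h 7
  unfold mergeCode
  have key : ∀ t0 t1 t2 t3 t4 t5 t6 t7 : ℕ, t0 < 8 → t1 < 8 → t2 < 8 → t3 < 8 → t4 < 8 → t5 < 8 →
      t6 < 8 → t7 < 8 → ∀ w : Fin 8, dig (t0 + 8 * t1 + 8 ^ 2 * t2 + 8 ^ 3 * t3 + 8 ^ 4 * t4 +
        8 ^ 5 * t5 + 8 ^ 6 * t6 + 8 ^ 7 * t7) w = ![t0, t1, t2, t3, t4, t5, t6, t7] w := by
    intro t0 t1 t2 t3 t4 t5 t6 t7 _ _ _ _ _ _ _ _ w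
    fin_cases w <;> simp [dig] <;> omega
  rw [key _ _ _ _ _ _ _ _ h0 h1 h2 h3 h4 h5 h6 h7]
  fin_cases v <;> rfl

/-- The labelling `s` describes the components of the graph with edge set `S`. -/
def Inv (S : Set (Sym2 (Fin 8))) (s c : ℕ) : Prop :=
  (∀ u v : Fin 8, (SimpleGraph.fromEdgeSet S).Reachable u v ↔ dig s u = dig s v) ∧
  c = (Finset.univ.image fun v : Fin 8 => dig s v).card

theorem Inv.numComponents {S : Set (Sym2 (Fin 8))} {s c : ℕ} (h : Inv S s c) :
    numComponents (Fin 8) S = c := by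
  obtain ⟨h1, h2⟩ := h
  unfold BNGraph.numComponents
  rw [h2]
  let f : (SimpleGraph.fromEdgeSet S).ConnectedComponent → ℕ :=
    SimpleGraph.ConnectedComponent.lift (fun v => dig s v)
      (fun u v p _ => (h1 u v).1 ⟨p⟩)
  have hf : Function.Injective f := by
    intro C D
    refine SimpleGraph.ConnectedComponent.ind₂ (fun u v h => ?_) C D
    exact SimpleGraph.ConnectedComponent.eq.2 ((h1 u v).2 h)
  rw [← Nat.card_range_of_injective hf, ← Set.ncard_coe_finset, ← Nat.card_coe_set_eq]
  congr 2
  ext x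
  simp only [Finset.coe_image, Finset.coe_univ, Set.image_univ, Set.mem_range]
  constructor
  · rintro ⟨C, rfl⟩
    induction C using SimpleGraph.ConnectedComponent.ind with
    | h v => exact ⟨v, rfl⟩
  · rintro ⟨v, rfl⟩
    exact ⟨SimpleGraph.connectedComponentMk _ v, rfl⟩

theorem reachable_lab {S : Set (Sym2 (Fin 8))} (f : Fin 8 → ℕ)
    (h : ∀ u v, s(u, v) ∈ S → f u = f v) {u v : Fin 8}
    (hr : (SimpleGraph.fromEdgeSet S).Reachable u v) : f u = f v := by
  obtain ⟨p⟩ := hr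
  induction p with
  | nil => rfl
  | cons hadj _ ih =>
    rw [SimpleGraph.fromEdgeSet_adj] at hadj
    exact (h _ _ hadj.1).trans ih

theorem reach_mem {S : Set (Sym2 (Fin 8))} {u v : Fin 8} (h : s(u, v) ∈ S) :
    (SimpleGraph.fromEdgeSet S).Reachable u v := by
  by_cases huv : u = v
  · subst huv; exact SimpleGraph.Reachable.refl _
  · exact SimpleGraph.Adj.reachable ((SimpleGraph.fromEdgeSet_adj S).2 ⟨h, huv⟩)

theorem inv_empty : Inv ∅ s0 8 := by
  have hd : ∀ v : Fin 8, dig s0 v = v := by decide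
  constructor
  · intro u v
    rw [hd, hd]
    constructor
    · intro h
      exact reachable_lab (fun v => (v : ℕ)) (by simp) h
    · intro h
      rw [Fin.ext h]
  · simp only [hd]
    decide

theorem Inv.insert_same {S : Set (Sym2 (Fin 8))} {s c : ℕ} (h : Inv S s c) {a b : Fin 8}
    (hab : dig s a = dig s b) : Inv (insert s(a, b) S) s c := by
  obtain ⟨h1, h2⟩ := h
  refine ⟨fun u v => ⟨fun hr => ?_, fun hr => ?_⟩, h2⟩
  · refine reachable_lab (fun v => dig s v) ?_ hr
    intro u v huv
    rcases huv with huv | huv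
    · rw [Sym2.eq_iff] at huv
      rcases huv with ⟨rfl, rfl⟩ | ⟨rfl, rfl⟩
      · exact hab
      · exact hab.symm
    · exact (h1 u v).1 (reach_mem huv)
  · exact ((h1 u v).2 hr).mono (SimpleGraph.fromEdgeSet_mono (Set.subset_insert _ _))

theorem Inv.insert_diff {S : Set (Sym2 (Fin 8))} {s c : ℕ} (h : Inv S s c) {a b : Fin 8}
    (hab : dig s a ≠ dig s b) :
    Inv (insert s(a, b) S) (mergeCode s (dig s a) (dig s b)) (c - 1) := by
  obtain ⟨h1, h2⟩ := h
  have hd := fun v : Fin 8 => dig_mergeCode s (dig s a) (dig s b) (dig_lt s a) v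
  refine ⟨fun u v => ⟨fun hr => ?_, fun hr => ?_⟩, ?_⟩
  · refine reachable_lab (fun v => dig (mergeCode s (dig s a) (dig s b)) v) ?_ hr
    intro u v huv
    simp only [hd]
    rcases huv with huv | huv
    · rw [Sym2.eq_iff] at huv
      rcases huv with ⟨rfl, rfl⟩ | ⟨rfl, rfl⟩ <;> simp
    · rw [(h1 u v).1 (reach_mem huv)]
  · have hmono : ∀ u v : Fin 8, dig s u = dig s v →
        (SimpleGraph.fromEdgeSet (insert s(a, b) S)).Reachable u v := fun u v h =>
      ((h1 u v).2 h).mono (SimpleGraph.fromEdgeSet_mono (Set.subset_insert _ _))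
    have hE : (SimpleGraph.fromEdgeSet (insert s(a, b) S)).Reachable a b :=
      reach_mem (Set.mem_insert _ _)
    rw [hd, hd] at hr
    split_ifs at hr with hu hv hv
    · exact hmono u v (hu.trans hv.symm)
    · exact ((hmono u b hu).trans hE.symm).trans (hmono a v hr)
    · exact ((hmono u a hr).trans hE).trans (hmono b v hv.symm)
    · exact hmono u v hr
  · have : (Finset.univ.image fun v : Fin 8 => dig (mergeCode s (dig s a) (dig s b)) v) =
        (Finset.univ.image fun v : Fin 8 => dig s v).erase (dig s b) := by
      ext x
      simp only [hd, Finset.mem_image, Finset.mem_univ, true_and, Finset.mem_erase]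
      constructor
      · rintro ⟨v, rfl⟩
        split_ifs with hv
        · exact ⟨hab, a, rfl⟩
        · exact ⟨hv, v, rfl⟩
      · rintro ⟨hx, v, rfl⟩
        exact ⟨v, by rw [if_neg hx]⟩
    rw [this, Finset.card_erase_of_mem (Finset.mem_image_of_mem _ (Finset.mem_univ b)), h2]

/-- Code of a subset of edges. -/
noncomputable def keyOf (A : Finset (Sym2 (Fin 8))) : ℕ :=
  16 * numComponents (Fin 8) (A : Set (Sym2 (Fin 8))) + A.card

/-- The edge with given endpoints. -/
def toE (e : Fin 8 × Fin 8) : Sym2 (Fin 8) := s(e.1, e.2)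

theorem go_spec (es : List (Fin 8 × Fin 8)) (A0 : Finset (Sym2 (Fin 8))) (s c : ℕ)
    (hnd : (es.map toE).Nodup) (hdis : ∀ e ∈ es.map toE, e ∉ A0)
    (h : Inv (A0 : Set (Sym2 (Fin 8))) s c) :
    go (es.map fun e => ((e.1 : ℕ), (e.2 : ℕ))) s c A0.card =
      ∑ A ∈ (es.map toE).toFinset.powerset, 8192 ^ keyOf (A0 ∪ A) := by
  induction es generalizing A0 s c with
  | nil => simp [go, keyOf, h.numComponents]
  | cons e es ih =>
    simp only [List.map_cons, List.nodup_cons] at hnd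
    have he : toE e ∉ A0 := hdis _ (by simp)
    have hne : toE e ∉ (es.map toE).toFinset := by simpa using hnd.1
    have hcard : (insert (toE e) A0).card = A0.card + 1 := Finset.card_insert_of_notMem he
    have hdis1 : ∀ f ∈ es.map toE, f ∉ A0 := fun f hf => hdis f (by
      rw [List.map_cons]; exact List.mem_cons_of_mem _ hf)
    have hdis2 : ∀ f ∈ es.map toE, f ∉ insert (toE e) A0 := by
      intro f hf hmem
      rcases Finset.mem_insert.1 hmem with rfl | h'
      · exact hnd.1 hf
      · exact hdis1 f hf h'
    rw [List.map_cons, List.map_cons, List.toFinset_cons, Finset.sum_powerset_insert hne]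
    simp only [go, force_eq]
    rw [ih A0 s c hnd.2 hdis1 h]
    congr 1
    have hun : ∀ A, A0 ∪ insert (toE e) A = insert (toE e) A0 ∪ A := by
      intro A; ext x; simp
    simp only [hun]
    by_cases hab : dig s e.1 = dig s e.2
    · rw [hab, Nat.beq_refl, cond_true, ← hcard]
      apply ih _ _ _ hnd.2 hdis2
      rw [Finset.coe_insert]
      exact h.insert_same hab
    · have hb : Nat.beq (dig s e.1) (dig s e.2) = false := by
        rw [Bool.eq_false_iff]
        exact fun h' => hab (Nat.eq_of_beq_eq_true h')
      rw [hb, cond_false, ← hcard]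
      apply ih _ _ _ hnd.2 hdis2
      rw [Finset.coe_insert]
      exact h.insert_diff hab

theorem digits_unique (B : ℕ) (K : ℕ) (p q : ℕ → ℕ) (hp : ∀ i, p i < B) (hq : ∀ i, q i < B)
    (h : ∑ i ∈ Finset.range K, p i * B ^ i = ∑ i ∈ Finset.range K, q i * B ^ i) :
    ∀ i < K, p i = q i := by
  induction K generalizing p q with
  | zero => intro i hi; omega
  | succ K ih =>
    have hB : 0 < B := lt_of_le_of_lt (Nat.zero_le _) (hp 0)
    have hs : ∀ r : ℕ → ℕ, ∑ i ∈ Finset.range (K + 1), r i * B ^ i =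
        r 0 + B * ∑ i ∈ Finset.range K, r (i + 1) * B ^ i := by
      intro r
      rw [Finset.sum_range_succ', Finset.mul_sum, add_comm]
      congr 1
      · simp
      · apply Finset.sum_congr rfl
        intro i _
        ring
    rw [hs, hs] at h
    have h0 : p 0 = q 0 := by
      have := congrArg (· % B) h
      simpa [Nat.add_mul_mod_self_left, Nat.mod_eq_of_lt (hp 0), Nat.mod_eq_of_lt (hq 0)] using this
    rw [h0] at h
    have h1 := Nat.eq_of_mul_eq_mul_left hB (Nat.add_left_cancel h)
    have h2 := ih (fun i => p (i + 1)) (fun i => q (i + 1)) (fun i => hp _) (fun i => hq _) h1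
    intro i hi
    cases i with
    | zero => exact h0
    | succ i => exact h2 i (by omega)

theorem sum_transfer {ι R : Type} [CommRing R] (S T : Finset ι) (κ : ι → ℕ) (B : ℕ)
    (hS : S.card < B) (hT : T.card < B)
    (h : ∑ A ∈ S, B ^ κ A = ∑ A ∈ T, B ^ κ A) (F : ℕ → R) :
    ∑ A ∈ S, F (κ A) = ∑ A ∈ T, F (κ A) := by
  obtain ⟨K, hKS, hKT⟩ : ∃ K, (∀ A ∈ S, κ A < K) ∧ (∀ A ∈ T, κ A < K) := by
    refine ⟨(S ∪ T).sup κ + 1, fun A hA => ?_, fun A hA => ?_⟩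
    · exact Nat.lt_succ_of_le (Finset.le_sup (f := κ) (Finset.mem_union_left _ hA))
    · exact Nat.lt_succ_of_le (Finset.le_sup (f := κ) (Finset.mem_union_right _ hA))
  have hfib : ∀ (R' : Type) [CommSemiring R'] (F' : ℕ → R') (U : Finset ι), (∀ A ∈ U, κ A < K) →
      ∑ A ∈ U, F' (κ A) =
        ∑ i ∈ Finset.range K, ((U.filter fun A => κ A = i).card : R') * F' i := by
    intro R' _ F' U hU
    rw [← Finset.sum_fiberwise_of_maps_to (g := κ) (t := Finset.range K)
      (fun A hA => Finset.mem_range.2 (hU A hA))]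
    apply Finset.sum_congr rfl
    intro i _
    rw [Finset.sum_congr rfl (g := fun _ => F' i)
      (fun A hA => by rw [(Finset.mem_filter.1 hA).2])]
    simp
  rw [hfib ℕ (fun i => B ^ i) S hKS, hfib ℕ (fun i => B ^ i) T hKT] at h
  have hu := digits_unique B K (fun i => (S.filter fun A => κ A = i).card)
    (fun i => (T.filter fun A => κ A = i).card)
    (fun i => lt_of_le_of_lt (Finset.card_filter_le _ _) hS)
    (fun i => lt_of_le_of_lt (Finset.card_filter_le _ _) hT) (by simpa using h)
  rw [hfib R F S hKS, hfib R F T hKT]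
  apply Finset.sum_congr rfl
  intro i hi
  have := hu i (Finset.mem_range.1 hi)
  rw [this]

open MvPolynomial in
/-- The summand of the Tutte polynomial in terms of the code. -/
noncomputable def tutteTerm (i : ℕ) : MvPolynomial (Fin 2) ℤ :=
  (X 0 - 1) ^ (i / 16 - 1) * (X 1 - 1) ^ (i / 16 + i % 16 - 8)

theorem numComponents_connected {G : SimpleGraph (Fin 8)} (h : G.Connected) :
    numComponents (Fin 8) G.edgeSet = 1 := by
  unfold numComponents
  rw [SimpleGraph.fromEdgeSet_edgeSet, Nat.card_eq_one_iff_unique]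
  have := h.preconnected.subsingleton_connectedComponent
  exact ⟨this, ⟨SimpleGraph.connectedComponentMk _ 0⟩⟩

theorem tutte_eq {G : SimpleGraph (Fin 8)} (h : G.Connected) (T : Finset (Sym2 (Fin 8)))
    (hT : (T : Set (Sym2 (Fin 8))) = G.edgeSet) (hc : T.card = 12) :
    tutte G = ∑ A ∈ T.powerset, tutteTerm (keyOf A) := by
  have : G.edgeFinset = T := by
    apply Finset.coe_injective
    rw [SimpleGraph.coe_edgeFinset, hT]
  unfold tutte
  rw [this]
  apply Finset.sum_congr rfl
  intro A hA
  have hcard : A.card ≤ 12 := hc ▸ Finset.card_le_card (Finset.mem_powerset.1 hA)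
  have h1 : keyOf A / 16 = numComponents (Fin 8) (A : Set (Sym2 (Fin 8))) := by
    unfold keyOf; omega
  have h2 : keyOf A % 16 = A.card := by
    unfold keyOf; omega
  rw [tutteTerm, h1, h2, numComponents_connected h, Fintype.card_fin]

/-- The edges of the two graphs. -/
def eG : List (Fin 8 × Fin 8) :=
  [(0, 3), (0, 5), (0, 6), (1, 3), (1, 7), (2, 3), (2, 6), (2, 7), (3, 6), (4, 5), (4, 6), (5, 7)]

def eH : List (Fin 8 × Fin 8) :=
  [(0, 1), (0, 4), (0, 5), (1, 3), (2, 3), (2, 5), (3, 4), (3, 6), (4, 6), (4, 7), (5, 7), (6, 7)]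

/-- The graph with a given edge list. -/
def mkG (es : List (Fin 8 × Fin 8)) : SimpleGraph (Fin 8) :=
  SimpleGraph.fromEdgeSet {e | e ∈ es.map toE}

set_option maxRecDepth 100000 in
theorem check_go : go (eG.map fun e => ((e.1 : ℕ), (e.2 : ℕ))) s0 8 0 =
    go (eH.map fun e => ((e.1 : ℕ), (e.2 : ℕ))) s0 8 0 := by decide +kernel

theorem edgeSet_mkG (es : List (Fin 8 × Fin 8)) (h : ∀ e ∈ es, e.1 ≠ e.2) :
    (((es.map toE).toFinset : Finset (Sym2 (Fin 8))) : Set (Sym2 (Fin 8))) = (mkG es).edgeSet := by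
  unfold mkG
  rw [SimpleGraph.edgeSet_fromEdgeSet]
  ext x
  simp only [List.coe_toFinset, Set.mem_sdiff]
  constructor
  · intro hx
    refine ⟨hx, ?_⟩
    obtain ⟨e, he, rfl⟩ := List.mem_map.1 hx
    simpa [toE] using h e he
  · intro hx
    exact hx.1

theorem nodup_eG : (eG.map toE).Nodup := by decide
theorem nodup_eH : (eH.map toE).Nodup := by decide

theorem card_edges (es : List (Fin 8 × Fin 8)) (h : (es.map toE).Nodup) (hl : es.length = 12) :
    (es.map toE).toFinset.card = 12 := by
  rw [List.toFinset_card_of_nodup h, List.length_map, hl]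

theorem edgeCount_mkG (es : List (Fin 8 × Fin 8)) (h : (es.map toE).Nodup) (hl : es.length = 12)
    (hne : ∀ e ∈ es, e.1 ≠ e.2) : edgeCount (mkG es) = 12 := by
  unfold edgeCount
  rw [← edgeSet_mkG es hne, Nat.card_coe_set_eq, Set.ncard_coe_finset, card_edges es h hl]

theorem ne_eG : ∀ e ∈ eG, e.1 ≠ e.2 := by decide
theorem ne_eH : ∀ e ∈ eH, e.1 ≠ e.2 := by decide

theorem tutte_same (hG : (mkG eG).Connected) (hH : (mkG eH).Connected) :
    tutte (mkG eG) = tutte (mkG eH) := by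
  rw [tutte_eq hG _ (edgeSet_mkG eG ne_eG) (card_edges eG nodup_eG rfl),
    tutte_eq hH _ (edgeSet_mkG eH ne_eH) (card_edges eH nodup_eH rfl)]
  apply sum_transfer (B := 8192)
  · rw [Finset.card_powerset, card_edges eG nodup_eG rfl]; norm_num
  · rw [Finset.card_powerset, card_edges eH nodup_eH rfl]; norm_num
  · have h1 := go_spec eG ∅ s0 8 nodup_eG (by simp) (by simpa using inv_empty)
    have h2 := go_spec eH ∅ s0 8 nodup_eH (by simp) (by simpa using inv_empty)
    simp only [Finset.empty_union, Finset.card_empty] at h1 h2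
    rw [← h1, ← h2, check_go]

/-! ### The two concrete graphs -/

theorem mkG_adj (es : List (Fin 8 × Fin 8)) (u v : Fin 8) :
    (mkG es).Adj u v ↔ s(u, v) ∈ es.map toE ∧ u ≠ v := by
  unfold mkG
  rw [SimpleGraph.fromEdgeSet_adj]
  rfl

/-- Boolean adjacency. -/
def adjB (es : List (Fin 8 × Fin 8)) (u v : Fin 8) : Bool :=
  es.any fun e => (e.1 == u && e.2 == v) || (e.1 == v && e.2 == u)

theorem adj_iff_adjB (es : List (Fin 8 × Fin 8)) (h : ∀ e ∈ es, e.1 ≠ e.2) (u v : Fin 8) :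
    (mkG es).Adj u v ↔ adjB es u v = true := by
  rw [mkG_adj]
  simp only [adjB, List.any_eq_true, List.mem_map, toE, Sym2.eq_iff, Bool.or_eq_true,
    Bool.and_eq_true, beq_iff_eq]
  constructor
  · exact fun h => h.1
  · rintro ⟨e, he, h1⟩
    refine ⟨⟨e, he, h1⟩, ?_⟩
    have := h e he
    rcases h1 with ⟨rfl, rfl⟩ | ⟨rfl, rfl⟩
    · exact this
    · exact this.symm

theorem connected_of (G : SimpleGraph (Fin 8)) (h : ∀ v, G.Reachable 0 v) : G.Connected :=
  { preconnected := fun u v => (h u).symm.trans (h v), nonempty := ⟨0⟩ }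

theorem lap_apply (G : SimpleGraph (Fin 8)) (f : Fin 8 → ℤ) (v : Fin 8) :
    lap G f v = ∑ w, if G.Adj v w then f v - f w else 0 := by
  have h1 : lap G f v = (G.degree v : ℤ) * f v - ∑ w ∈ G.neighborFinset v, f w := rfl
  rw [h1, ← Finset.sum_filter, ← SimpleGraph.neighborFinset_eq_filter, Finset.sum_sub_distrib,
    Finset.sum_const, SimpleGraph.card_neighborFinset_eq_degree, nsmul_eq_mul]

theorem lap_mkG (es : List (Fin 8 × Fin 8)) (h : ∀ e ∈ es, e.1 ≠ e.2) (f : Fin 8 → ℤ)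
    (v : Fin 8) :
    lap (mkG es) f v = ∑ w, bif adjB es v w then f v - f w else 0 := by
  rw [lap_apply]
  apply Finset.sum_congr rfl
  intro w _
  by_cases hw : adjB es v w = true
  · rw [if_pos ((adj_iff_adjB es h v w).2 hw), hw, cond_true]
  · rw [if_neg (fun h' => hw ((adj_iff_adjB es h v w).1 h')), Bool.eq_false_iff.2 hw, cond_false]

theorem conn_G : (mkG eG).Connected := by
  have hadj : ∀ u v, adjB eG u v = true → (mkG eG).Reachable u v :=
    fun u v h => ((adj_iff_adjB eG ne_eG u v).2 h).reachable
  have h3 := hadj 0 3 (by decide)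
  have h5 := hadj 0 5 (by decide)
  have h6 := hadj 0 6 (by decide)
  have h1 := h3.trans (hadj 3 1 (by decide))
  have h2 := h3.trans (hadj 3 2 (by decide))
  have h4 := h5.trans (hadj 5 4 (by decide))
  have h7 := h5.trans (hadj 5 7 (by decide))
  apply connected_of
  intro v
  fin_cases v
  exacts [SimpleGraph.Reachable.refl _, h1, h2, h3, h4, h5, h6, h7]

theorem conn_H : (mkG eH).Connected := by
  have hadj : ∀ u v, adjB eH u v = true → (mkG eH).Reachable u v :=
    fun u v h => ((adj_iff_adjB eH ne_eH u v).2 h).reachable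
  have h1 := hadj 0 1 (by decide)
  have h4 := hadj 0 4 (by decide)
  have h5 := hadj 0 5 (by decide)
  have h3 := h1.trans (hadj 1 3 (by decide))
  have h2 := h3.trans (hadj 3 2 (by decide))
  have h6 := h4.trans (hadj 4 6 (by decide))
  have h7 := h5.trans (hadj 5 7 (by decide))
  apply connected_of
  intro v
  fin_cases v
  exacts [SimpleGraph.Reachable.refl _, h1, h2, h3, h4, h5, h6, h7]

/-- The homomorphism with given integer weights. -/
def wHom (m n : ℕ) (x y : Fin 8 → ℤ) : (Fin 8 → ℤ) →+ ZMod m × ZMod n where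
  toFun D := (((∑ v, D v * x v : ℤ) : ZMod m), ((∑ v, D v * y v : ℤ) : ZMod n))
  map_zero' := by simp
  map_add' D E := by
    simp [add_mul, Finset.sum_add_distrib]

theorem wHom_eq_zero (m n : ℕ) (x y : Fin 8 → ℤ) (D : Fin 8 → ℤ) :
    wHom m n x y D = 0 ↔ (m : ℤ) ∣ ∑ v, D v * x v ∧ (n : ℤ) ∣ ∑ v, D v * y v := by
  rw [← ZMod.intCast_zmod_eq_zero_iff_dvd, ← ZMod.intCast_zmod_eq_zero_iff_dvd, Prod.ext_iff]
  rfl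

theorem wHom_single (m n : ℕ) (x y : Fin 8 → ℤ) (v : Fin 8) (c : ℤ) :
    wHom m n x y (Pi.single v c) = (((c * x v : ℤ) : ZMod m), ((c * y v : ℤ) : ZMod n)) := by
  have h : ∀ z : Fin 8 → ℤ, ∑ w, (Pi.single v c : Fin 8 → ℤ) w * z w = c * z v := by
    intro z
    rw [Finset.sum_eq_single v]
    · simp
    · intro w _ hw; simp [hw]
    · simp
  change (((∑ w, (Pi.single v c : Fin 8 → ℤ) w * x w : ℤ) : ZMod m),
    ((∑ w, (Pi.single v c : Fin 8 → ℤ) w * y w : ℤ) : ZMod n)) = _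
  rw [h, h]

def xG : Fin 8 → ℤ := ![0, 0, 1, 22, 31, 17, 3, 20]
def yG : Fin 8 → ℤ := ![0, 1, 0, 5, 1, 4, 5, 4]
def xH : Fin 8 → ℤ := ![0, 154, 1, 14, 152, 282, 43, 257]

theorem lapG_values (f : Fin 8 → ℤ) : lap (mkG eG) f =
    ![3 * f 0 - f 3 - f 5 - f 6, 2 * f 1 - f 3 - f 7, 3 * f 2 - f 3 - f 6 - f 7,
      4 * f 3 - f 0 - f 1 - f 2 - f 6, 2 * f 4 - f 5 - f 6, 3 * f 5 - f 0 - f 4 - f 7,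
      4 * f 6 - f 0 - f 2 - f 3 - f 4, 3 * f 7 - f 1 - f 2 - f 5] := by
  funext v
  rw [lap_mkG eG ne_eG]
  fin_cases v <;> simp [Fin.sum_univ_eight, adjB, eG] <;> ring

theorem lapH_values (f : Fin 8 → ℤ) : lap (mkG eH) f =
    ![3 * f 0 - f 1 - f 4 - f 5, 2 * f 1 - f 0 - f 3, 2 * f 2 - f 3 - f 5,
      4 * f 3 - f 1 - f 2 - f 4 - f 6, 4 * f 4 - f 0 - f 3 - f 6 - f 7,
      3 * f 5 - f 0 - f 2 - f 7, 3 * f 6 - f 3 - f 4 - f 7, 3 * f 7 - f 4 - f 5 - f 6] := by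
  funext v
  rw [lap_mkG eH ne_eH]
  fin_cases v <;> simp [Fin.sum_univ_eight, adjB, eH] <;> ring

theorem ker_G (D : Fin 8 → ℤ) :
    D ∈ Principal (mkG eG) ↔ degSum D = 0 ∧ wHom 42 7 xG yG D = 0 := by
  rw [wHom_eq_zero]
  constructor
  · rintro ⟨f, rfl⟩
    rw [lapG_values]
    simp only [degSum, Fin.sum_univ_eight, xG, yG]
    simp
    omega
  · rintro ⟨h0, ⟨s, hs⟩, ⟨t, ht⟩⟩
    simp [degSum, Fin.sum_univ_eight, xG, yG] at h0 hs ht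
    refine ⟨![0, (-14) * D 3 + (-14) * D 4 + (-11) * D 5 + (-6) * D 6 + (-12) * D 7 + (18) * s + (7) * t, (-18) * D 3 + (-23) * D 4 + (-14) * D 5 + (-4) * D 6 + (-16) * D 7 + (31) * s + (3) * t, (-10) * D 3 + (-12) * D 4 + (-8) * D 5 + (-3) * D 6 + (-9) * D 7 + (16) * s + (3) * t, (-8) * D 3 + (-9) * D 4 + (-6) * D 5 + (-2) * D 6 + (-7) * D 7 + (13) * s + (2) * t, (-7) * D 3 + (-8) * D 4 + (-5) * D 5 + (-2) * D 6 + (-6) * D 7 + (11) * s + (2) * t, (-9) * D 3 + (-11) * D 4 + (-7) * D 5 + (-2) * D 6 + (-8) * D 7 + (15) * s + (2) * t, (-13) * D 3 + (-15) * D 4 + (-10) * D 5 + (-4) * D 6 + (-11) * D 7 + (20) * s + (4) * t], ?_⟩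
    rw [lapG_values]
    funext v
    fin_cases v <;> simp <;> linarith

theorem ker_H (D : Fin 8 → ℤ) :
    D ∈ Principal (mkG eH) ↔ degSum D = 0 ∧ wHom 294 1 xH 0 D = 0 := by
  rw [wHom_eq_zero]
  constructor
  · rintro ⟨f, rfl⟩
    rw [lapH_values]
    simp only [degSum, Fin.sum_univ_eight, xH]
    simp
    omega
  · rintro ⟨h0, ⟨s, hs⟩, -⟩
    simp [degSum, Fin.sum_univ_eight, xH] at h0 hs
    refine ⟨![0, (-36) * D 1 + (-3) * D 3 + (-36) * D 4 + (-67) * D 5 + (-10) * D 6 + (-61) * D 7 + (70) * s, (-148) * D 1 + (-13) * D 3 + (-146) * D 4 + (-271) * D 5 + (-41) * D 6 + (-247) * D 7 + (283) * s, (-73) * D 1 + (-6) * D 3 + (-72) * D 4 + (-134) * D 5 + (-20) * D 6 + (-122) * D 7 + (140) * s, (-48) * D 1 + (-4) * D 3 + (-47) * D 4 + (-88) * D 5 + (-13) * D 6 + (-80) * D 7 + (92) * s, (-69) * D 1 + (-6) * D 3 + (-68) * D 4 + (-126) * D 5 + (-19) * D 6 + (-115) * D 7 + (132) * s, (-60)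 * D 1 + (-5) * D 3 + (-59) * D 4 + (-110) * D 5 + (-16) * D 6 + (-100) * D 7 + (115) * s, (-59) * D 1 + (-5) * D 3 + (-58) * D 4 + (-108) * D 5 + (-16) * D 6 + (-98) * D 7 + (113) * s], ?_⟩
    rw [lapH_values]
    funext v
    fin_cases v <;> simp <;> linarith

/-- The model for the first graph. -/
def modelG : PicModel (mkG eG) (ZMod 42 × ZMod 7) where
  ψ := wHom 42 7 xG yG
  ker := ker_G
  zero := by rw [wHom_single]; simp [xG, yG]
  surj := by
    rintro ⟨p, q⟩
    obtain ⟨p, rfl⟩ := ZMod.intCast_surjective p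
    obtain ⟨q, rfl⟩ := ZMod.intCast_surjective q
    refine ⟨Pi.single 2 p + Pi.single 1 q, ?_⟩
    rw [map_add, wHom_single, wHom_single]
    simp [xG, yG]

/-- The model for the second graph. -/
def modelH : PicModel (mkG eH) (ZMod 294 × ZMod 1) where
  ψ := wHom 294 1 xH 0
  ker := ker_H
  zero := by rw [wHom_single]; simp [xH]
  surj := by
    rintro ⟨p, q⟩
    obtain ⟨p, rfl⟩ := ZMod.intCast_surjective p
    refine ⟨Pi.single 2 p, ?_⟩
    rw [wHom_single]
    refine Prod.ext ?_ (Subsingleton.elim _ _)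
    simp [xH]

theorem codes_of (m n : ℕ) (l : List (ℕ × ℕ)) (x y : Fin 8 → ℤ) (a : Fin 8 → ZMod m × ZMod n)
    (ha : ∀ v, a v = wHom m n x y (Pi.single v 1))
    (h1 : ∀ e ∈ l, e.1 ≤ m ∧ e.2 ≤ n)
    (h2 : ∀ v, ∃ e ∈ l, x v = (e.1 : ℤ) ∧ y v = (e.2 : ℤ))
    (h3 : ∀ e ∈ l, ∃ v, x v = (e.1 : ℤ) ∧ y v = (e.2 : ℤ)) : Codes m n l a := by
  refine ⟨h1, fun v => ?_, fun e he => ?_⟩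
  · obtain ⟨e, he, hx, hy⟩ := h2 v
    refine ⟨e, he, ?_⟩
    rw [ha, wHom_single, hx, hy]
    simp
  · obtain ⟨v, hx, hy⟩ := h3 e he
    refine ⟨v, ?_⟩
    rw [ha, wHom_single, hx, hy]
    simp

theorem codes_G : Codes 42 7 aG modelG.a :=
  codes_of 42 7 aG xG yG _ (fun _ => rfl) (by decide) (by decide) (by decide)

theorem codes_H : Codes 294 1 aH modelH.a :=
  codes_of 294 1 aH xH 0 _ (fun _ => rfl) (by decide) (by decide) (by decide)

theorem tables (d0 k : ℕ) (h : d0 + k < 9) :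
    cnt (maskR 42 7 aG d0 k) (42 * 7) = cnt (maskR 294 1 aH d0 k) (294 * 1) :=
  chkW_spec 42 7 aG 294 1 aH 9 0 check_tables d0 k (by omega) (by omega)

theorem sameZeta : SameZeta (mkG eG) (mkG eH) := by
  have t4 : cnt (maskW 42 7 aG 4) (42 * 7) = cnt (maskW 294 1 aH 4) (294 * 1) := tables 4 0 (by omega)
  have t5 : cnt (maskW 42 7 aG 5) (42 * 7) = cnt (maskW 294 1 aH 5) (294 * 1) := tables 5 0 (by omega)
  have u4 : cnt (maskW 42 7 aG 4) (42 * 7) = 202 := check_W4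
  have u5 : cnt (maskW 42 7 aG 5) (42 * 7) = 294 := check_W5
  refine sameZeta_of_models modelG modelH ?_ ?_ ?_ ?_ ?_ ?_
  · rw [card_model, card_model]
  · exact all_W codes_G 5 (by rw [u5])
  · exact not_all_W codes_G 4 (by rw [u4]; norm_num)
  · exact all_W codes_H 5 (by rw [← t5, u5])
  · exact not_all_W codes_H 4 (by rw [← t4, u4]; norm_num)
  · intro d0 k h
    rw [ncard_Rp codes_G, ncard_Rp codes_H, tables d0 k h]

theorem jac_H : Nonempty (Jac (mkG eH) ≃+ ZMod 294) := by
  obtain ⟨e⟩ := modelH.jac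
  exact ⟨e.trans (AddEquiv.prodUnique)⟩

theorem groups_not_iso : ¬ Nonempty ((ZMod 42 × ZMod 7) ≃+ ZMod 294) := by
  rintro ⟨e⟩
  have h1 : ∀ z : ZMod 42 × ZMod 7, 42 • z = 0 := by decide +kernel
  have h2 := h1 (e.symm 1)
  rw [← map_nsmul] at h2
  have h3 : (42 • (1 : ZMod 294)) = 0 := by
    rwa [EmbeddingLike.map_eq_zero_iff] at h2
  exact absurd h3 (by decide)

/-- There are connected simple graphs on 8 vertices with 12 edges (hence of genus 5)
with equal Tutte polynomials and the same two-variable zeta function, whose Jacobians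
are `ℤ/42ℤ × ℤ/7ℤ` and `ℤ/294ℤ` respectively; in particular the Jacobians are not
isomorphic. -/
theorem exists_genus5_sameTutte_sameZeta_nonIsoJac :
    ∃ G G' : SimpleGraph (Fin 8),
      G.Connected ∧ G'.Connected ∧
      edgeCount G = 12 ∧ edgeCount G' = 12 ∧
      tutte G = tutte G' ∧
      SameZeta G G' ∧
      Nonempty (Jac G ≃+ (ZMod 42 × ZMod 7)) ∧
      Nonempty (Jac G' ≃+ ZMod 294) ∧
      ¬ Nonempty (Jac G ≃+ Jac G') := by
  obtain ⟨e⟩ := modelG.jac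
  obtain ⟨e2⟩ := jac_H
  exact ⟨mkG eG, mkG eH, conn_G, conn_H, edgeCount_mkG eG nodup_eG rfl ne_eG,
    edgeCount_mkG eH nodup_eH rfl ne_eH, tutte_same conn_G conn_H, sameZeta, ⟨e⟩, ⟨e2⟩,
    fun ⟨f⟩ => groups_not_iso ⟨(e.symm.trans f).trans e2⟩⟩

end BNGraph
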